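/- arXiv:2412.01995 — 3 statements merged into one kernel-verified Lean document; each statement's English description precedes it below -/
import Mathlib

section
/- For every x in the open subprobability simplex Δ, the determinant of one half of the Hessian of w satisfies det(½∇²w(x)) = (∏_{i=1}^d 1/x_i²) · (1 + (∑_{i=1}^d x_i²)/(1 − ∑_{i=1}^d x_i)²). -/
open Real Filter MeasureTheory
open scoped Matrix

noncomputable section

/-- The open subprobability simplex in `ℝ^d`. -/
def simplexΔ (d : ℕ) : Set (Fin d → ℝ) := {x | (∀ i, 0 < x i) ∧ ∑ i, x i < 1}

/-- Hessian matrix of `u` at `x` (entries `∂²u/∂xᵢ∂xⱼ`). -/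
def hess (d : ℕ) (u : (Fin d → ℝ) → ℝ) (x : Fin d → ℝ) : Matrix (Fin d) (Fin d) ℝ :=
  Matrix.of fun i j => fderiv ℝ (fun y => fderiv ℝ u y (Pi.single j 1)) x (Pi.single i 1)

/-- The barrier function `w(x) = -2∑ log xᵢ - 2 log(1-∑xᵢ)`. -/
def wbar (d : ℕ) (x : Fin d → ℝ) : ℝ :=
  -2 * ∑ i, Real.log (x i) - 2 * Real.log (1 - ∑ i, x i)

/-- Gradient of `u` at `x`. -/
def gradv (d : ℕ) (u : (Fin d → ℝ) → ℝ) (x : Fin d → ℝ) : Fin d → ℝ :=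
  fun i => fderiv ℝ u x (Pi.single i 1)

/-- Directional derivatives of the barrier along coordinate directions. -/
theorem fderiv_wbar_single {d : ℕ} {y : Fin d → ℝ} (hy : y ∈ simplexΔ d) (j : Fin d) :
    fderiv ℝ (wbar d) y (Pi.single j 1) = -2 * (y j)⁻¹ + 2 * (1 - ∑ i, y i)⁻¹ := by
  obtain ⟨hpos, hsum⟩ := hy
  have hcoord (i : Fin d) : HasFDerivAt (fun z : Fin d → ℝ => z i)
      (ContinuousLinearMap.proj (R := ℝ) i) y := hasFDerivAt_apply i y
  have hlog : HasFDerivAt (fun z : Fin d → ℝ => ∑ i, Real.log (z i))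
      (∑ i, (y i)⁻¹ • ContinuousLinearMap.proj (R := ℝ) i) y :=
    HasFDerivAt.fun_sum fun i _ => (hcoord i).log (hpos i).ne'
  have hslack := (HasFDerivAt.fun_sum (u := Finset.univ) fun i _ => hcoord i).const_sub 1
  have hw : HasFDerivAt (wbar d) _ y :=
    (hlog.const_mul (-2)).sub ((hslack.log (sub_pos.2 hsum).ne').const_mul 2)
  rw [hw.fderiv]
  simp [Pi.single_apply]

/-- The open subprobability simplex is open. -/
theorem isOpen_simplexΔ (d : ℕ) : IsOpen (simplexΔ d) := by
  simp only [simplexΔ, Set.ofPred_and, Set.ofPred_forall]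
  exact (isOpen_iInter_of_finite fun i => isOpen_lt continuous_const (continuous_apply i)).inter
    (isOpen_lt (by fun_prop) continuous_const)

/-- The Hessian of the barrier is a rank-one perturbation of a diagonal matrix. -/
theorem hess_wbar {d : ℕ} {x : Fin d → ℝ} (hx : x ∈ simplexΔ d) :
    hess d (wbar d) x = Matrix.of fun i j =>
      (if i = j then 2 / x i ^ 2 else 0) + 2 / (1 - ∑ k, x k) ^ 2 := by
  ext i j
  have hcoord (k : Fin d) : HasFDerivAt (fun z : Fin d → ℝ => z k)
      (ContinuousLinearMap.proj (R := ℝ) k) x := hasFDerivAt_apply k x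
  have hgrad : (fun y => fderiv ℝ (wbar d) y (Pi.single j 1)) =ᶠ[nhds x]
      fun y => -2 * (y j)⁻¹ + 2 * (1 - ∑ k, y k)⁻¹ := by
    filter_upwards [(isOpen_simplexΔ d).mem_nhds hx] with y hy
    exact fderiv_wbar_single hy j
  obtain ⟨hpos, hsum⟩ := hx
  have hslack := (HasFDerivAt.fun_sum (u := Finset.univ) fun k _ => hcoord k).const_sub 1
  have hinv := (hasDerivAt_inv (hpos j).ne').comp_hasFDerivAt x (hcoord j)
  have hinv_slack := (hasDerivAt_inv (sub_pos.2 hsum).ne').comp_hasFDerivAt x hslack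
  have hderiv : HasFDerivAt (fun y : Fin d → ℝ => -2 * (y j)⁻¹ + 2 * (1 - ∑ k, y k)⁻¹) _ x :=
    (hinv.const_mul (-2)).add (hinv_slack.const_mul 2)
  simp only [hess, Matrix.of_apply]
  rw [hgrad.fderiv_eq, hderiv.fderiv]
  by_cases hij : i = j
  · subst hij
    simp [Pi.single_apply, div_eq_mul_inv]
  · simp [Pi.single_apply, div_eq_mul_inv, hij, Ne.symm hij]

/-- Determinant of one half of the Hessian of the barrier function. -/
theorem det_half_hessian_barrier (d : ℕ) (hd : 1 ≤ d) (x : Fin d → ℝ)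
    (hx : x ∈ simplexΔ d) :
    ((2 : ℝ)⁻¹ • hess d (wbar d) x).det =
      (∏ i, 1 / x i ^ 2) * (1 + (∑ i, x i ^ 2) / (1 - ∑ i, x i) ^ 2) := by
  have hne (i : Fin d) : x i ≠ 0 := (hx.1 i).ne'
  have hfactor : (2 : ℝ)⁻¹ • hess d (wbar d) x =
      Matrix.diagonal (fun i => 1 / x i ^ 2) *
        (1 + Matrix.replicateCol Unit (fun i => x i ^ 2) *
          Matrix.replicateRow Unit (fun _ => 1 / (1 - ∑ k, x k) ^ 2)) := by
    rw [hess_wbar hx]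
    ext i j
    rw [Matrix.diagonal_mul]
    have := hne i
    by_cases hij : i = j
    · subst hij
      simp [Matrix.mul_apply]
      field_simp
    · simp [Matrix.mul_apply, hij]
      field_simp
  rw [hfactor, Matrix.det_mul, Matrix.det_diagonal,
    Matrix.det_one_add_replicateCol_mul_replicateRow]
  simp [dotProduct, div_eq_inv_mul, Finset.mul_sum]
end
end

section
/- The Monge–Ampère problem with infinite boundary data on the simplex has at most one solution: if g₁ and g₂ are both C^∞ functions on Δ with everywhere positive definite Hessian, satisfying g_k(x) = log det(½∇²g_k(x)) for all x ∈ Δ and g_k(x) → +∞ as x → x⁰ for every x⁰ ∈ ∂Δ (k = 1,2), then g₁ = g₂ on Δ. -/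
open Real Filter MeasureTheory
open scoped Matrix

noncomputable section

theorem Matrix.PosSemidef.one_le_det_one_add {n : Type*} [Fintype n] [DecidableEq n]
    {Q : Matrix n n ℝ} (hQ : Q.PosSemidef) : 1 ≤ (1 + Q).det := by
  set U := hQ.1.eigenvectorUnitary
  have h : 1 + Q = Unitary.conjStarAlgAut ℝ _ U
      (1 + Matrix.diagonal hQ.1.eigenvalues) := by
    rw [map_add, map_one]
    congr 1
    exact hQ.1.spectral_theorem
  rw [h, Unitary.conjStarAlgAut_apply, Matrix.det_mul_right_comm,
    Unitary.mul_star_self_of_mem U.2, one_mul, ← Matrix.diagonal_one, Matrix.diagonal_add,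
    Matrix.det_diagonal]
  refine Finset.prod_induction _ (fun a : ℝ => 1 ≤ a) (fun _ _ => one_le_mul_of_one_le_of_one_le)
    le_rfl fun i _ => by simpa using hQ.eigenvalues_nonneg i

open scoped MatrixOrder in
/-- The determinant is monotone for the Loewner order above a positive definite matrix. -/
theorem Matrix.PosDef.det_le_det_of_posSemidef_sub {n : Type*} [Fintype n] [DecidableEq n]
    {A B : Matrix n n ℝ} (hA : A.PosDef) (hAB : (B - A).PosSemidef) : A.det ≤ B.det := by
  obtain ⟨S, hS⟩ := CStarAlgebra.nonneg_iff_eq_star_mul_self.mp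
    (Matrix.nonneg_iff_posSemidef.mpr hA.posSemidef)
  rw [Matrix.star_eq_conjTranspose] at hS
  have hdet : IsUnit S.det := by
    have := hA.det_pos
    rw [hS, Matrix.det_mul] at this
    exact (right_ne_zero_of_mul this.ne').isUnit
  have hQ := hAB.conjTranspose_mul_mul_same S⁻¹
  have hB : B = Sᴴ * (1 + S⁻¹ᴴ * (B - A) * S⁻¹) * S := by
    have h₁ : Sᴴ * S⁻¹ᴴ = 1 := by
      rw [← Matrix.conjTranspose_mul, Matrix.nonsing_inv_mul _ hdet, Matrix.conjTranspose_one]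
    have h₂ : S⁻¹ * S = 1 := Matrix.nonsing_inv_mul _ hdet
    calc B = Sᴴ * S + (Sᴴ * S⁻¹ᴴ) * (B - A) * (S⁻¹ * S) := by
          rw [h₁, h₂, one_mul, mul_one, ← hS, add_sub_cancel]
      _ = _ := by noncomm_ring
  rw [hB, Matrix.det_mul_right_comm, ← hS, Matrix.det_mul]
  exact le_mul_of_one_le_right hA.det_pos.le hQ.one_le_det_one_add

/-- The second-order necessary condition for a local minimum on the line. -/
theorem IsLocalMin.second_deriv_nonneg {f f' : ℝ → ℝ} {a c : ℝ} (hmin : IsLocalMin f a)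
    (hf : ∀ᶠ t in nhds a, HasDerivAt f (f' t) t) (hf' : HasDerivAt f' c a) : 0 ≤ c := by
  by_contra! hc
  have heq : deriv f =ᶠ[nhds a] f' := hf.mono fun t ht => ht.deriv
  have hcd : deriv (deriv f) a = c := by rw [heq.deriv_eq, hf'.deriv]
  have hmax : IsLocalMax f a :=
    isLocalMax_of_deriv_deriv_neg (by rwa [hcd]) hmin.deriv_eq_zero hf.self_of_nhds.continuousAt
  have hconst : f =ᶠ[nhds a] fun _ => f a := by
    filter_upwards [hmin, hmax] with t h₁ h₂ using le_antisymm h₂ h₁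
  have : deriv (deriv f) a = 0 := by
    rw [hconst.deriv.deriv_eq]
    simp
  exact hc.ne (hcd.symm.trans this)

section Line

variable {d : ℕ} {S : Set (Fin d → ℝ)} {u : (Fin d → ℝ) → ℝ} {x : Fin d → ℝ}

theorem hasDerivAt_add_smul (x v : Fin d → ℝ) (t : ℝ) :
    HasDerivAt (fun s : ℝ => x + s • v) v t := by
  simpa using ((hasDerivAt_id t).smul_const v).const_add x

theorem eventually_hasDerivAt_comp_line (hS : IsOpen S) (hu : ContDiffOn ℝ (⊤ : ℕ∞) u S)
    (hx : x ∈ S) (v : Fin d → ℝ) :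
    ∀ᶠ t : ℝ in nhds 0,
      HasDerivAt (fun s : ℝ => u (x + s • v)) (fderiv ℝ u (x + t • v) v) t := by
  have hmem : ∀ᶠ t : ℝ in nhds 0, x + t • v ∈ S :=
    (hasDerivAt_add_smul x v 0).continuousAt.eventually_mem (hS.mem_nhds (by simpa using hx))
  filter_upwards [hmem] with t ht
  have hd : DifferentiableAt ℝ u (x + t • v) :=
    (hu.contDiffAt (hS.mem_nhds ht)).differentiableAt (by simp)
  exact hd.hasFDerivAt.comp_hasDerivAt t (hasDerivAt_add_smul x v t)

theorem hasDerivAt_fderiv_line (hS : IsOpen S) (hu : ContDiffOn ℝ (⊤ : ℕ∞) u S)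
    (hx : x ∈ S) (v : Fin d → ℝ) :
    HasDerivAt (fun t : ℝ => fderiv ℝ u (x + t • v) v) (v ⬝ᵥ (hess d u x *ᵥ v)) 0 := by
  have hd : DifferentiableAt ℝ (fderiv ℝ u) x :=
    ((hu.contDiffAt (hS.mem_nhds hx)).fderiv_right (m := 1) (by norm_cast)).differentiableAt
      (by simp)
  have hline : HasDerivAt (fun t : ℝ => fderiv ℝ u (x + t • v)) (fderiv ℝ (fderiv ℝ u) x v) 0 := by
    have hd' : DifferentiableAt ℝ (fderiv ℝ u) (x + (0 : ℝ) • v) := by simpa using hd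
    simpa [Function.comp_def] using
      hd'.hasFDerivAt.comp_hasDerivAt 0 (hasDerivAt_add_smul x v 0)
  have hentry (i j : Fin d) :
      hess d u x i j = fderiv ℝ (fderiv ℝ u) x (Pi.single i 1) (Pi.single j 1) := by
    simp [hess, fderiv_clm_apply hd (differentiableAt_const _)]
  have hv : v = ∑ i, v i • (Pi.single i 1 : Fin d → ℝ) := pi_eq_sum_univ' v
  have hquad : v ⬝ᵥ (hess d u x *ᵥ v) = fderiv ℝ (fderiv ℝ u) x v v := by
    conv_rhs => rw [hv]
    simp [dotProduct, Matrix.mulVec, hentry, Finset.mul_sum, mul_comm]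
    rw [Finset.sum_comm]
    exact Finset.sum_congr rfl fun _ _ => Finset.sum_congr rfl fun _ _ => mul_left_comm _ _ _
  rw [hquad]
  simpa using hline.clm_apply (hasDerivAt_const (0 : ℝ) v)

end Line

theorem posSemidef_hess_sub_of_isLocalMin {d : ℕ} {S : Set (Fin d → ℝ)} (hS : IsOpen S)
    {g₁ g₂ : (Fin d → ℝ) → ℝ}
    (hg₁ : ContDiffOn ℝ (⊤ : ℕ∞) g₁ S) (hg₂ : ContDiffOn ℝ (⊤ : ℕ∞) g₂ S)
    {c x : Fin d → ℝ} {r : ℝ} (hx : x ∈ S) (hy : c + r • x ∈ S)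
    (hh₁ : (hess d g₁ (c + r • x)).IsHermitian) (hh₂ : (hess d g₂ x).IsHermitian)
    (hmin : IsLocalMin (fun z => g₂ z - g₁ (c + r • z)) x) :
    (hess d g₂ x - r ^ 2 • hess d g₁ (c + r • x)).PosSemidef := by
  refine .of_dotProduct_mulVec_nonneg (hh₂.sub (hh₁.smul (by simp [IsSelfAdjoint]))) fun v => ?_
  have hline : IsLocalMin
      (fun t : ℝ => g₂ (x + t • v) - g₁ (c + r • x + t • (r • v))) 0 := by
    have hcont : Tendsto (fun t : ℝ => x + t • v) (nhds 0) (nhds x) := by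
      simpa using (hasDerivAt_add_smul x v 0).continuousAt.tendsto
    filter_upwards [hcont.eventually hmin] with t ht
    convert ht using 2 <;> simp [smul_add, smul_comm t r, add_assoc]
  have h := hline.second_deriv_nonneg
    (((eventually_hasDerivAt_comp_line hS hg₂ hx v).and
      (eventually_hasDerivAt_comp_line hS hg₁ hy (r • v))).mono fun t ht => ht.1.sub ht.2)
    ((hasDerivAt_fderiv_line hS hg₂ hx v).sub (hasDerivAt_fderiv_line hS hg₁ hy (r • v)))
  simpa [Matrix.sub_mulVec, Matrix.smul_mulVec, Matrix.mulVec_smul, pow_two, mul_assoc] using h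

/-- A continuous function on a bounded open set that blows up at the boundary attains its
infimum. -/
theorem exists_isMinOn_of_tendsto_frontier {d : ℕ} {S : Set (Fin d → ℝ)}
    (hbdd : Bornology.IsBounded S) (hne : S.Nonempty) {u : (Fin d → ℝ) → ℝ}
    (hS : IsOpen S) (hu : ContinuousOn u S)
    (hlim : ∀ x ∈ frontier S, Tendsto u (nhdsWithin x S) atTop) :
    ∃ x ∈ S, IsMinOn u S x := by
  obtain ⟨x₀, hx₀⟩ := hne
  set K : Set (Fin d → ℝ) := {x ∈ S | u x ≤ u x₀}
  have hclosed : IsClosed K := by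
    refine isClosed_of_closure_subset fun y hy => ?_
    have hfreq : ∃ᶠ z in nhdsWithin y S, u z ≤ u x₀ := by
      rw [frequently_nhdsWithin_iff]
      exact (mem_closure_iff_frequently.mp hy).mono fun z hz => ⟨hz.2, hz.1⟩
    by_cases hyS : y ∈ S
    · refine ⟨hyS, ?_⟩
      by_contra! hlt
      exact hfreq (((hu y hyS).eventually (lt_mem_nhds hlt)).mono fun z hz => hz.not_ge)
    · have hyf : y ∈ frontier S := by
        rw [hS.frontier_eq]
        exact ⟨closure_mono (Set.sep_subset _ _) hy, hyS⟩
      exact absurd (((hlim y hyf).eventually_gt_atTop (u x₀)).mono fun z hz => hz.not_ge) hfreq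
  have hK : IsCompact K :=
    Metric.isCompact_of_isClosed_isBounded hclosed (hbdd.subset (Set.sep_subset _ _))
  obtain ⟨x, hx, hmin⟩ := hK.exists_isMinOn ⟨x₀, hx₀, le_rfl⟩ (hu.mono (Set.sep_subset _ _))
  refine ⟨x, hx.1, fun z hz => ?_⟩
  rcases le_total (u z) (u x₀) with h | h
  · exact hmin ⟨hz, h⟩
  · exact (hmin ⟨hx₀, le_rfl⟩ : u x ≤ u x₀).trans h

/-- The dilation of a Monge–Ampère solution about an interior point of a convex domain is, up to
an additive constant, a solution on a larger domain, hence lies below any solution with infinite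
boundary values. -/
theorem MA_dilation_le {d : ℕ} {S : Set (Fin d → ℝ)} (hS : IsOpen S) (hconv : Convex ℝ S)
    (hbdd : Bornology.IsBounded S) {g₁ g₂ : (Fin d → ℝ) → ℝ}
    (hg₁ : ContDiffOn ℝ (⊤ : ℕ∞) g₁ S) (hpos₁ : ∀ x ∈ S, (hess d g₁ x).PosDef)
    (hMA₁ : ∀ x ∈ S, g₁ x = Real.log (((2 : ℝ)⁻¹ • hess d g₁ x).det))
    (hg₂ : ContDiffOn ℝ (⊤ : ℕ∞) g₂ S) (hpos₂ : ∀ x ∈ S, (hess d g₂ x).PosDef)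
    (hMA₂ : ∀ x ∈ S, g₂ x = Real.log (((2 : ℝ)⁻¹ • hess d g₂ x).det))
    (hbd₂ : ∀ x ∈ frontier S, Tendsto g₂ (nhdsWithin x S) atTop)
    {c : Fin d → ℝ} (hc : c ∈ S) {r : ℝ} (hr₀ : 0 < r) (hr₁ : r < 1)
    {x : Fin d → ℝ} (hx : x ∈ S) :
    g₁ ((1 - r) • c + r • x) + d * Real.log (r ^ 2) ≤ g₂ x := by
  have hmaps {y : Fin d → ℝ} (hy : y ∈ closure S) : (1 - r) • c + r • y ∈ S := by
    have := hconv.combo_interior_closure_mem_interior (hS.interior_eq.symm ▸ hc) hy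
      (sub_pos.mpr hr₁) hr₀.le (sub_add_cancel 1 r)
    rwa [hS.interior_eq] at this
  have hcont {y : Fin d → ℝ} (hy : y ∈ closure S) :
      ContinuousAt (fun z => g₁ ((1 - r) • c + r • z)) y :=
    ContinuousAt.comp (f := fun z : Fin d → ℝ => (1 - r) • c + r • z)
      (hg₁.continuousOn.continuousAt (hS.mem_nhds (hmaps hy))) (by fun_prop)
  obtain ⟨m, hm, hmin⟩ := exists_isMinOn_of_tendsto_frontier
    (u := fun z => g₂ z - g₁ ((1 - r) • c + r • z)) hbdd ⟨x, hx⟩ hS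
    (hg₂.continuousOn.sub fun y hy => (hcont (subset_closure hy)).continuousWithinAt)
    fun y hy => by
      simp only [sub_eq_add_neg]
      exact (hbd₂ y hy).atTop_add
        ((hcont (frontier_subset_closure hy)).neg.tendsto.mono_left nhdsWithin_le_nhds)
  have hm' := hmaps (subset_closure hm)
  have hpsd := posSemidef_hess_sub_of_isLocalMin hS hg₁ hg₂ hm hm' (hpos₁ _ hm').1 (hpos₂ _ hm).1
    (hmin.isLocalMin (hS.mem_nhds hm))
  have hdet : ((2 : ℝ)⁻¹ • r ^ 2 • hess d g₁ ((1 - r) • c + r • m)).det ≤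
      ((2 : ℝ)⁻¹ • hess d g₂ m).det := by
    refine (((hpos₁ _ hm').smul (pow_pos hr₀ 2)).smul (by norm_num)).det_le_det_of_posSemidef_sub ?_
    rw [← smul_sub]
    exact hpsd.smul (by norm_num)
  have hdet₁ : 0 < ((2 : ℝ)⁻¹ • hess d g₁ ((1 - r) • c + r • m)).det :=
    ((hpos₁ _ hm').smul (by norm_num)).det_pos
  rw [smul_comm, Matrix.det_smul, Fintype.card_fin] at hdet
  have hlog := Real.log_le_log (mul_pos (pow_pos (pow_pos hr₀ 2) d) hdet₁) hdet
  rw [Real.log_mul (pow_pos (pow_pos hr₀ 2) d).ne' hdet₁.ne', Real.log_pow, ← hMA₁ _ hm',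
    ← hMA₂ _ hm] at hlog
  have := hmin hx
  simp only [Set.mem_ofPred_eq] at this
  linarith

theorem MA_le_of_tendsto_frontier {d : ℕ} {S : Set (Fin d → ℝ)} (hS : IsOpen S)
    (hconv : Convex ℝ S) (hbdd : Bornology.IsBounded S) {g₁ g₂ : (Fin d → ℝ) → ℝ}
    (hg₁ : ContDiffOn ℝ (⊤ : ℕ∞) g₁ S) (hpos₁ : ∀ x ∈ S, (hess d g₁ x).PosDef)
    (hMA₁ : ∀ x ∈ S, g₁ x = Real.log (((2 : ℝ)⁻¹ • hess d g₁ x).det))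
    (hg₂ : ContDiffOn ℝ (⊤ : ℕ∞) g₂ S) (hpos₂ : ∀ x ∈ S, (hess d g₂ x).PosDef)
    (hMA₂ : ∀ x ∈ S, g₂ x = Real.log (((2 : ℝ)⁻¹ • hess d g₂ x).det))
    (hbd₂ : ∀ x ∈ frontier S, Tendsto g₂ (nhdsWithin x S) atTop)
    {x : Fin d → ℝ} (hx : x ∈ S) : g₁ x ≤ g₂ x := by
  -- Dilating about `x` itself fixes `x`.
  have hle : ∀ᶠ r : ℝ in nhdsWithin 1 (Set.Iio 1), g₁ x + d * Real.log (r ^ 2) ≤ g₂ x := by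
    filter_upwards [Ioo_mem_nhdsLT (zero_lt_one' ℝ)] with r hr
    have := MA_dilation_le hS hconv hbdd hg₁ hpos₁ hMA₁ hg₂ hpos₂ hMA₂ hbd₂ hx hr.1 hr.2 hx
    rwa [← add_smul, sub_add_cancel, one_smul] at this
  have hcont : ContinuousAt (fun r : ℝ => g₁ x + d * Real.log (r ^ 2)) 1 := by
    fun_prop (disch := norm_num)
  have hlim : Tendsto (fun r : ℝ => g₁ x + d * Real.log (r ^ 2)) (nhdsWithin 1 (Set.Iio 1))
      (nhds (g₁ x)) := by
    simpa using hcont.tendsto.mono_left nhdsWithin_le_nhds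
  exact le_of_tendsto hlim hle

theorem convex_simplexΔ (d : ℕ) : Convex ℝ (simplexΔ d) := by
  refine convex_iff_forall_pos.mpr fun x hx y hy a b ha hb hab => ⟨fun i => ?_, ?_⟩
  · have := mul_pos ha (hx.1 i)
    have := mul_pos hb (hy.1 i)
    simp only [Pi.add_apply, Pi.smul_apply, smul_eq_mul]
    linarith
  · simp only [Pi.add_apply, Pi.smul_apply, smul_eq_mul, Finset.sum_add_distrib,
      ← Finset.mul_sum]
    nlinarith [hx.2, hy.2, mul_lt_mul_of_pos_left hx.2 ha, mul_lt_mul_of_pos_left hy.2 hb]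

theorem isBounded_simplexΔ (d : ℕ) : Bornology.IsBounded (simplexΔ d) := by
  refine (Metric.isBounded_Icc (0 : Fin d → ℝ) 1).subset fun x hx => ⟨fun i => (hx.1 i).le,
    fun i => ?_⟩
  exact (Finset.single_le_sum (fun j _ => (hx.1 j).le) (Finset.mem_univ i)).trans hx.2.le

/-- Uniqueness of the solution to the Monge–Ampère equation on the simplex with
infinite boundary values. -/
theorem MA_solution_unique (d : ℕ) (hd : 1 ≤ d)
    (g₁ g₂ : (Fin d → ℝ) → ℝ)
    (hg₁ : ContDiffOn ℝ (⊤ : ℕ∞) g₁ (simplexΔ d))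
    (hpos₁ : ∀ x ∈ simplexΔ d, (hess d g₁ x).PosDef)
    (hMA₁ : ∀ x ∈ simplexΔ d, g₁ x = Real.log (((2 : ℝ)⁻¹ • hess d g₁ x).det))
    (hbd₁ : ∀ x0 ∈ frontier (simplexΔ d),
      Filter.Tendsto g₁ (nhdsWithin x0 (simplexΔ d)) Filter.atTop)
    (hg₂ : ContDiffOn ℝ (⊤ : ℕ∞) g₂ (simplexΔ d))
    (hpos₂ : ∀ x ∈ simplexΔ d, (hess d g₂ x).PosDef)
    (hMA₂ : ∀ x ∈ simplexΔ d, g₂ x = Real.log (((2 : ℝ)⁻¹ • hess d g₂ x).det))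
    (hbd₂ : ∀ x0 ∈ frontier (simplexΔ d),
      Filter.Tendsto g₂ (nhdsWithin x0 (simplexΔ d)) Filter.atTop) :
    Set.EqOn g₁ g₂ (simplexΔ d) := by
  exact fun x hx => le_antisymm
    (MA_le_of_tendsto_frontier (isOpen_simplexΔ d) (convex_simplexΔ d) (isBounded_simplexΔ d)
      hg₁ hpos₁ hMA₁ hg₂ hpos₂ hMA₂ hbd₂ hx)
    (MA_le_of_tendsto_frontier (isOpen_simplexΔ d) (convex_simplexΔ d) (isBounded_simplexΔ d)
      hg₂ hpos₂ hMA₂ hg₁ hpos₁ hMA₁ hbd₁ hx)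
end
end

section
/- Let g be a C^∞ function on Δ with everywhere positive definite Hessian satisfying g(x) = log det(½∇²g(x)) for all x ∈ Δ and g(x) → +∞ as x approaches any boundary point of Δ. Then sup_{x ∈ Δ} ∇g(x)^⊤ (∇²g(x))^{-1} ∇g(x) < ∞, i.e. there exists a finite constant C such that ∇g(x)^⊤ (∇²g(x))^{-1} ∇g(x) ≤ C for all x ∈ Δ. -/
open Real Filter MeasureTheory
open scoped Matrix

noncomputable section

section LinearAlgebra

open Matrix

/-- A positive definite and a symmetric real matrix are simultaneously diagonalizable by a
congruence. -/
theorem Matrix.PosDef.exists_simultaneous_congruence {n : Type*} [Fintype n] [DecidableEq n]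
    {A B : Matrix n n ℝ} (hA : A.PosDef) (hB : B.IsHermitian) :
    ∃ (S : Matrix n n ℝ) (μ : n → ℝ), Sᵀ * A * S = 1 ∧ Sᵀ * B * S = diagonal μ := by
  have key : ∀ C : Matrix n n ℝ, ∀ hC : C.IsHermitian,
      (hC.eigenvectorUnitary : Matrix n n ℝ)ᵀ * C * (hC.eigenvectorUnitary : Matrix n n ℝ)
        = diagonal hC.eigenvalues := by
    intro C hC
    have h := hC.conjStarAlgAut_star_eigenvectorUnitary
    rw [Unitary.conjStarAlgAut_apply] at h
    simpa [star_eq_conjTranspose, conjTranspose_eq_transpose_of_trivial, Function.comp_def] using h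
  set U : Matrix n n ℝ := (hA.isHermitian.eigenvectorUnitary : Matrix n n ℝ) with hU
  have hUA : Uᵀ * A * U = diagonal hA.isHermitian.eigenvalues := key A hA.isHermitian
  set D : Matrix n n ℝ := diagonal fun i => (√(hA.isHermitian.eigenvalues i))⁻¹ with hD
  have hDt : Dᵀ = D := diagonal_transpose _
  have hR : (U * D)ᵀ * A * (U * D) = 1 := by
    calc (U * D)ᵀ * A * (U * D) = D * (Uᵀ * A * U) * D := by
          rw [transpose_mul, hDt]; simp only [Matrix.mul_assoc]
      _ = 1 := by
          rw [hUA, hD, diagonal_mul_diagonal, diagonal_mul_diagonal, ← diagonal_one]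
          congr 1
          funext i
          have h := hA.eigenvalues_pos i
          have h2 := Real.sqrt_pos.2 h
          have h3 := Real.mul_self_sqrt h.le
          field_simp
          nlinarith
  have hC : ((U * D)ᵀ * B * (U * D)).IsHermitian := by
    have := isHermitian_conjTranspose_mul_mul (U * D) hB
    rwa [conjTranspose_eq_transpose_of_trivial] at this
  set V : Matrix n n ℝ := (hC.eigenvectorUnitary : Matrix n n ℝ) with hV
  refine ⟨U * D * V, hC.eigenvalues, ?_, ?_⟩
  · calc (U * D * V)ᵀ * A * (U * D * V) = Vᵀ * ((U * D)ᵀ * A * (U * D)) * V := by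
          rw [transpose_mul (U * D)]; simp only [Matrix.mul_assoc]
      _ = 1 := by
          rw [hR, Matrix.mul_one]
          have := Unitary.coe_star_mul_self hC.eigenvectorUnitary
          rwa [star_eq_conjTranspose, conjTranspose_eq_transpose_of_trivial] at this
  · calc (U * D * V)ᵀ * B * (U * D * V) = Vᵀ * ((U * D)ᵀ * B * (U * D)) * V := by
          rw [transpose_mul (U * D)]; simp only [Matrix.mul_assoc]
      _ = _ := key _ hC

theorem Matrix.dotProduct_congruence_mulVec {n : Type*} [Fintype n] (S A : Matrix n n ℝ)
    (w : n → ℝ) : (S *ᵥ w) ⬝ᵥ A *ᵥ (S *ᵥ w) = w ⬝ᵥ (Sᵀ * A * S) *ᵥ w := by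
  rw [← mulVec_mulVec, ← mulVec_mulVec, dotProduct_mulVec w Sᵀ, vecMul_transpose]

theorem Matrix.dotProduct_diagonal_mulVec {n : Type*} [Fintype n] [DecidableEq n] (k w : n → ℝ) :
    w ⬝ᵥ (diagonal k) *ᵥ w = ∑ i, k i * w i ^ 2 := by
  simp only [dotProduct, mulVec_diagonal]
  exact Finset.sum_congr rfl fun i _ => by ring

/-- The determinant is monotone on positive definite matrices. -/
theorem Matrix.PosDef.det_le_det {n : Type*} [Fintype n] [DecidableEq n]
    {A B : Matrix n n ℝ} (hA : A.PosDef) (hB : B.PosDef)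
    (h : ∀ v, v ⬝ᵥ B *ᵥ v ≤ v ⬝ᵥ A *ᵥ v) : B.det ≤ A.det := by
  obtain ⟨S, μ, hSA, hSB⟩ := hA.exists_simultaneous_congruence hB.isHermitian
  have hdA : S.det * A.det * S.det = 1 := by
    simpa using congrArg det hSA
  have hdB : S.det * B.det * S.det = ∏ i, μ i := by
    simpa using congrArg det hSB
  have hcoord : ∀ i, 0 ≤ μ i ∧ μ i ≤ 1 := by
    intro i
    have h1 := h (S *ᵥ Pi.single i 1)
    have h2 := hB.posSemidef.dotProduct_mulVec_nonneg (S *ᵥ Pi.single i 1)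
    rw [star_trivial] at h2
    rw [dotProduct_congruence_mulVec, hSB] at h2
    rw [dotProduct_congruence_mulVec, dotProduct_congruence_mulVec, hSA, hSB] at h1
    simp at h1 h2
    exact ⟨h2, h1⟩
  have hle : ∏ i, μ i ≤ 1 := Finset.prod_le_one (fun i _ => (hcoord i).1) fun i _ => (hcoord i).2
  have hS : 0 < S.det ^ 2 := by
    have : S.det ≠ 0 := by rintro h0; simp [h0] at hdA
    positivity
  nlinarith

/-- If `G ((a + b) / 2)` is dominated by the mean of `X a` and `Y b` with weights `r`, `s`, and
`r ^ 2 • X`, `s ^ 2 • Y` have the same determinant `c`, then `((r + s) / 2) ^ 2 • G` has determinant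
at most `c`. -/
theorem Matrix.PosDef.det_mul_pow_le_of_mean_bound {n : Type*} [Fintype n] [DecidableEq n]
    {X Y G : Matrix n n ℝ} (hX : X.PosDef) (hY : Y.PosDef) (hG : G.PosDef)
    {r s c : ℝ} (hr : 0 < r) (hs : 0 < s)
    (hXc : X.det * r ^ (2 * Fintype.card n) = c) (hYc : Y.det * s ^ (2 * Fintype.card n) = c)
    (h : ∀ a b : n → ℝ, (r + s) * ((2⁻¹ : ℝ) • (a + b) ⬝ᵥ G *ᵥ ((2⁻¹ : ℝ) • (a + b)))
      ≤ r * (a ⬝ᵥ X *ᵥ a) + s * (b ⬝ᵥ Y *ᵥ b)) :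
    G.det * ((r + s) / 2) ^ (2 * Fintype.card n) ≤ c := by
  obtain ⟨S, μ, hSX, hSY⟩ := hX.exists_simultaneous_congruence hY.isHermitian
  have hdX : S.det * X.det * S.det = 1 := by simpa using congrArg det hSX
  have hdY : S.det * Y.det * S.det = ∏ i, μ i := by simpa using congrArg det hSY
  have hS0 : S.det ≠ 0 := by rintro h0; simp [h0] at hdX
  have hS : 0 < S.det ^ 2 := by positivity
  have hSinj : Function.Injective S.mulVec :=
    mulVec_injective_of_isUnit ((isUnit_iff_isUnit_det S).2 (isUnit_iff_ne_zero.2 hS0))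
  have hμ : ∀ i, 0 < μ i := by
    have : (Sᵀ * Y * S).PosDef := by
      have := hY.conjTranspose_mul_mul_same hSinj
      rwa [conjTranspose_eq_transpose_of_trivial] at this
    rw [hSY] at this
    exact posDef_diagonal_iff.1 this
  have hG' : (Sᵀ * G * S).PosDef := by
    have := hG.conjTranspose_mul_mul_same hSinj
    rwa [conjTranspose_eq_transpose_of_trivial] at this
  set m : n → ℝ := fun i => (s / r) ^ 2 * μ i with hm
  have hm0 : ∀ i, 0 < m i := fun i => by have := hμ i; positivity
  have hμm : ∀ i, μ i = (r / s) ^ 2 * m i := fun i => by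
    simp only [hm]; field_simp
  have hm1 : ∏ i, m i = 1 := by
    simp only [hm, Finset.prod_mul_distrib, Finset.prod_const, Finset.card_univ, ← pow_mul]
    rw [← hdY, div_pow]
    have hrp : 0 < r ^ (2 * Fintype.card n) := by positivity
    field_simp
    have : Y.det * s ^ (2 * Fintype.card n) = X.det * r ^ (2 * Fintype.card n) := by
      rw [hXc, hYc]
    linear_combination S.det ^ 2 * this + r ^ (2 * Fintype.card n) * hdX
  set k : n → ℝ := fun i => 4 * r ^ 2 * m i / ((r + s) * (s + r * m i)) with hk
  have hk0 : ∀ i, 0 < k i := fun i => by have := hm0 i; positivity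
  have hbound : ∀ w, w ⬝ᵥ (Sᵀ * G * S) *ᵥ w ≤ w ⬝ᵥ (diagonal k) *ᵥ w := by
    intro w
    set a : n → ℝ := fun i => 2 * r * m i / (s + r * m i) * w i with ha
    set b : n → ℝ := fun i => 2 * s / (s + r * m i) * w i with hb
    have hab : (2⁻¹ : ℝ) • (S *ᵥ a + S *ᵥ b) = S *ᵥ w := by
      rw [← mulVec_add, ← mulVec_smul]
      congr 1
      funext i
      have := hm0 i
      simp only [Pi.smul_apply, Pi.add_apply, ha, hb, smul_eq_mul]
      field_simp
      ring
    have h1 := h (S *ᵥ a) (S *ᵥ b)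
    rw [hab] at h1
    simp only [dotProduct_congruence_mulVec, hSX, hSY] at h1
    rw [← diagonal_one, dotProduct_diagonal_mulVec, dotProduct_diagonal_mulVec] at h1
    rw [dotProduct_diagonal_mulVec]
    have h2 : r * ∑ i, 1 * a i ^ 2 + s * ∑ i, μ i * b i ^ 2
        = (r + s) * ∑ i, k i * w i ^ 2 := by
      rw [Finset.mul_sum, Finset.mul_sum, Finset.mul_sum, ← Finset.sum_add_distrib]
      refine Finset.sum_congr rfl fun i _ => ?_
      have := hm0 i
      simp only [ha, hb, hk, hμm i]
      field_simp
      ring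
    have h3 : (r + s) * (w ⬝ᵥ (Sᵀ * G * S) *ᵥ w) ≤ (r + s) * ∑ i, k i * w i ^ 2 := by
      rw [← h2]; exact h1
    exact le_of_mul_le_mul_left h3 (by positivity)
  have hdet := (PosDef.diagonal hk0).det_le_det hG' hbound
  simp only [det_mul, det_transpose, det_diagonal] at hdet
  have hprod : ∏ i, k i ≤ (2 * r / (r + s)) ^ (2 * Fintype.card n) := by
    have hle : ∀ i, k i ≤ (2 * r / (r + s)) ^ 2 * m i ^ (s / (r + s)) := by
      intro i
      have h1 := Real.geom_mean_le_arith_mean2_weighted (w₁ := s / (r + s)) (w₂ := r / (r + s))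
        (p₁ := 1) (p₂ := m i) (by positivity) (by positivity) zero_le_one (hm0 i).le
        (by field_simp; ring)
      rw [Real.one_rpow, one_mul] at h1
      have h2 : m i ^ (s / (r + s)) * m i ^ (r / (r + s)) = m i := by
        rw [← Real.rpow_add (hm0 i), ← add_div, add_comm s r, div_self (by positivity),
          Real.rpow_one]
      have h3 : 0 < m i ^ (s / (r + s)) := Real.rpow_pos_of_pos (hm0 i) _
      have h4 : (m i ^ (r / (r + s))) * (r + s) ≤ s + r * m i := by
        have : s / (r + s) * 1 + r / (r + s) * m i = (s + r * m i) / (r + s) := by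
          field_simp
        rwa [this, le_div_iff₀ (by positivity)] at h1
      have h5 : 0 < s + r * m i := by have := hm0 i; positivity
      have h6 : m i * (r + s) ≤ m i ^ (s / (r + s)) * (s + r * m i) := by
        calc m i * (r + s) = m i ^ (s / (r + s)) * ((m i ^ (r / (r + s))) * (r + s)) := by
              rw [← mul_assoc, h2]
          _ ≤ _ := by gcongr
      simp only [hk]
      rw [div_pow, div_mul_eq_mul_div, div_le_div_iff₀ (by positivity) (by positivity)]
      have : 0 ≤ 4 * r ^ 2 * (r + s) := by positivity
      nlinarith [mul_le_mul_of_nonneg_left h6 this]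
    calc ∏ i, k i ≤ ∏ i, (2 * r / (r + s)) ^ 2 * m i ^ (s / (r + s)) :=
          Finset.prod_le_prod (fun i _ => (hk0 i).le) fun i _ => hle i
      _ = _ := by
          rw [Finset.prod_mul_distrib, Real.finsetProd_rpow _ _ fun i _ => (hm0 i).le, hm1,
            Real.one_rpow, mul_one, Finset.prod_const, Finset.card_univ, pow_mul]
  have h1 : S.det * G.det * S.det * ((r + s) / 2) ^ (2 * Fintype.card n)
      ≤ r ^ (2 * Fintype.card n) := by
    calc S.det * G.det * S.det * ((r + s) / 2) ^ (2 * Fintype.card n)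
        ≤ (2 * r / (r + s)) ^ (2 * Fintype.card n) * ((r + s) / 2) ^ (2 * Fintype.card n) := by
          gcongr; exact hdet.trans hprod
      _ = _ := by
          rw [← mul_pow]
          congr 1
          field_simp
  have h2 : S.det ^ 2 * (G.det * ((r + s) / 2) ^ (2 * Fintype.card n)) ≤ S.det ^ 2 * c := by
    calc _ = S.det * G.det * S.det * ((r + s) / 2) ^ (2 * Fintype.card n) := by ring
      _ ≤ r ^ (2 * Fintype.card n) := h1
      _ = S.det ^ 2 * c := by
        rw [← hXc]; linear_combination (-r ^ (2 * Fintype.card n)) * hdX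
  exact le_of_mul_le_mul_left h2 hS

end LinearAlgebra

section SecondOrder

open scoped Topology

/-- `u` has first derivative `p` and second derivative `q` at `0`. -/
def HasSecondJet (u : ℝ → ℝ) (p q : ℝ) : Prop :=
  ∃ u' : ℝ → ℝ, (∀ᶠ s in 𝓝 0, HasDerivAt u (u' s) s) ∧ u' 0 = p ∧ HasDerivAt u' q 0

namespace HasSecondJet

variable {u v : ℝ → ℝ} {p q p' q' : ℝ}

theorem add (hu : HasSecondJet u p q) (hv : HasSecondJet v p' q') :
    HasSecondJet (fun s => u s + v s) (p + p') (q + q') := by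
  obtain ⟨u', h1, rfl, h2⟩ := hu
  obtain ⟨v', k1, rfl, k2⟩ := hv
  refine ⟨fun s => u' s + v' s, ?_, rfl, h2.add k2⟩
  filter_upwards [h1, k1] with s hs ks using hs.add ks

theorem const_mul (hu : HasSecondJet u p q) (c : ℝ) :
    HasSecondJet (fun s => c * u s) (c * p) (c * q) := by
  obtain ⟨u', h1, rfl, h2⟩ := hu
  refine ⟨fun s => c * u' s, ?_, rfl, h2.const_mul c⟩
  filter_upwards [h1] with s hs using hs.const_mul c

theorem exp (hu : HasSecondJet u p q) :
    HasSecondJet (fun s => Real.exp (u s)) (Real.exp (u 0) * p)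
      (Real.exp (u 0) * (p ^ 2 + q)) := by
  obtain ⟨u', h1, rfl, h2⟩ := hu
  refine ⟨fun s => Real.exp (u s) * u' s, ?_, rfl, ?_⟩
  · filter_upwards [h1] with s hs using hs.exp
  · refine (h1.self_of_nhds.exp.mul h2).congr_deriv ?_
    ring

theorem of_isLocalMax (hu : HasSecondJet u p q) (hmax : IsLocalMax u 0) : p = 0 ∧ q ≤ 0 := by
  obtain ⟨u', h1, rfl, h2⟩ := hu
  have hp : u' 0 = 0 := hmax.hasDerivAt_eq_zero h1.self_of_nhds
  refine ⟨hp, ?_⟩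
  by_contra! hq
  have hd : deriv u =ᶠ[𝓝 0] u' := by
    filter_upwards [h1] with s hs using hs.deriv
  have hmin : IsLocalMin u 0 :=
    isLocalMin_of_deriv_deriv_pos (by rw [hd.deriv_eq, h2.deriv]; exact hq)
      (by rw [hd.self_of_nhds, hp]) h1.self_of_nhds.continuousAt
  have hconst : u =ᶠ[𝓝 0] fun _ => u 0 := by
    filter_upwards [hmax, hmin] with s ha hb using le_antisymm ha hb
  have h3 : deriv (deriv u) 0 = 0 := by
    rw [hconst.deriv.deriv_eq]; simp
  rw [hd.deriv_eq, h2.deriv] at h3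
  exact hq.ne' h3

end HasSecondJet

theorem dotProduct_hess_mulVec {d : ℕ} {g : (Fin d → ℝ) → ℝ} {x : Fin d → ℝ}
    (h : DifferentiableAt ℝ (fderiv ℝ g) x) (v : Fin d → ℝ) :
    v ⬝ᵥ (hess d g x).mulVec v = fderiv ℝ (fderiv ℝ g) x v v := by
  have hentry : ∀ i j, hess d g x i j
      = fderiv ℝ (fderiv ℝ g) x (Pi.single i 1) (Pi.single j 1) := by
    intro i j
    simp only [hess, Matrix.of_apply]
    rw [fderiv_clm_apply h (differentiableAt_const _)]
    simp
  have hv : v = ∑ i, v i • (Pi.single i 1 : Fin d → ℝ) := pi_eq_sum_univ' v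
  conv_rhs => rw [hv]
  simp only [map_sum, map_smul, sum_apply, smul_apply,
    dotProduct, Matrix.mulVec, hentry, smul_eq_mul, Finset.mul_sum]
  rw [Finset.sum_comm]
  exact Finset.sum_congr rfl fun i _ => Finset.sum_congr rfl fun j _ => by ring

theorem dotProduct_gradv {d : ℕ} (g : (Fin d → ℝ) → ℝ) (x v : Fin d → ℝ) :
    gradv d g x ⬝ᵥ v = fderiv ℝ g x v := by
  have hv : v = ∑ i, v i • (Pi.single i 1 : Fin d → ℝ) := pi_eq_sum_univ' v
  conv_rhs => rw [hv]
  simp [dotProduct, gradv, mul_comm]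

theorem ContDiffAt.hasSecondJet_line {d : ℕ} {g : (Fin d → ℝ) → ℝ} {x : Fin d → ℝ}
    (hg : ContDiffAt ℝ 2 g x) (v : Fin d → ℝ) :
    HasSecondJet (fun s => g (x + s • v)) (fderiv ℝ g x v) (v ⬝ᵥ (hess d g x).mulVec v) := by
  have hline : ∀ s : ℝ, HasDerivAt (fun s : ℝ => x + s • v) v s := fun s => by
    simpa using ((hasDerivAt_id s).smul_const v).const_add x
  have hdd : DifferentiableAt ℝ (fderiv ℝ g) x :=
    (hg.fderiv_right (m := 1) (by norm_num)).differentiableAt (by norm_num)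
  have hx0 : x + (0 : ℝ) • v = x := by simp
  refine ⟨fun s => fderiv ℝ g (x + s • v) v, ?_, by simp, ?_⟩
  · have hev : ∀ᶠ y in 𝓝 x, DifferentiableAt ℝ g y := by
      filter_upwards [hg.eventually (by simp)] with y hy using hy.differentiableAt (by norm_num)
    have ht : Tendsto (fun s : ℝ => x + s • v) (𝓝 0) (𝓝 x) := by
      have := (hline 0).continuousAt.tendsto
      rwa [hx0] at this
    filter_upwards [ht.eventually hev] with s hs
    exact hs.hasFDerivAt.comp_hasDerivAt s (hline s)
  · rw [dotProduct_hess_mulVec hdd]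
    have h1 : HasFDerivAt (fderiv ℝ g) (fderiv ℝ (fderiv ℝ g) x) (x + (0 : ℝ) • v) := by
      rw [hx0]; exact hdd.hasFDerivAt
    have h2 := h1.comp_hasDerivAt (0 : ℝ) (hline 0)
    simpa using h2.clm_apply (hasDerivAt_const (0 : ℝ) v)

end SecondOrder

/-- A convex solution of `det ∇²g = 2 ^ d * exp g` on a bounded convex domain, tending to infinity
at the boundary. -/
structure IsBlowUpSolution (d : ℕ) (Ω : Set (Fin d → ℝ)) (g : (Fin d → ℝ) → ℝ) : Prop where
  isOpen : IsOpen Ω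
  convex : Convex ℝ Ω
  isBounded : Bornology.IsBounded Ω
  contDiffOn : ContDiffOn ℝ 2 g Ω
  posDef : ∀ x ∈ Ω, (hess d g x).PosDef
  det_eq : ∀ x ∈ Ω, (hess d g x).det = 2 ^ d * Real.exp (g x)
  tendsto : ∀ x ∈ frontier Ω, Tendsto g (nhdsWithin x Ω) atTop

/-- The function `exp (-g / 2d)` on `Ω`, extended by zero. -/
def profile (d : ℕ) (Ω : Set (Fin d → ℝ)) (g : (Fin d → ℝ) → ℝ) : (Fin d → ℝ) → ℝ :=
  Ω.indicator fun x => Real.exp (-(2 * d : ℝ)⁻¹ * g x)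

namespace IsBlowUpSolution

open scoped Topology

variable {d : ℕ} {Ω : Set (Fin d → ℝ)} {g : (Fin d → ℝ) → ℝ}

theorem contDiffAt (H : IsBlowUpSolution d Ω g) {x : Fin d → ℝ} (hx : x ∈ Ω) :
    ContDiffAt ℝ 2 g x :=
  H.contDiffOn.contDiffAt (H.isOpen.mem_nhds hx)

theorem profile_pos {x : Fin d → ℝ} (hx : x ∈ Ω) : 0 < profile d Ω g x := by
  rw [profile, Set.indicator_of_mem hx]; positivity

theorem profile_eq_zero {x : Fin d → ℝ} (hx : x ∉ Ω) : profile d Ω g x = 0 :=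
  Set.indicator_of_notMem hx _

theorem det_mul_profile_pow (H : IsBlowUpSolution d Ω g) (hd : 0 < d) {x : Fin d → ℝ}
    (hx : x ∈ Ω) : (hess d g x).det * profile d Ω g x ^ (2 * d) = 2 ^ d := by
  rw [H.det_eq x hx, profile, Set.indicator_of_mem hx, ← Real.exp_nat_mul, mul_assoc,
    ← Real.exp_add]
  have : (d : ℝ) ≠ 0 := by positivity
  have h0 : g x + ((2 * d : ℕ) : ℝ) * (-(2 * d : ℝ)⁻¹ * g x) = 0 := by
    push_cast
    field_simp
    ring
  rw [h0, Real.exp_zero, mul_one]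

theorem continuous_profile (H : IsBlowUpSolution d Ω g) (hd : 0 < d) :
    Continuous (profile d Ω g) := by
  rw [continuous_iff_continuousAt]
  intro x
  by_cases hx : x ∈ Ω
  · have h1 : ContinuousAt (fun x => Real.exp (-(2 * d : ℝ)⁻¹ * g x)) x :=
      ((H.contDiffAt hx).continuousAt.const_mul _).rexp
    refine h1.congr ?_
    filter_upwards [H.isOpen.mem_nhds hx] with y hy
    rw [profile, Set.indicator_of_mem hy]
  · rw [ContinuousAt, profile_eq_zero hx, ← nhdsWithin_univ, ← Set.union_compl_self Ω,
      nhdsWithin_union, tendsto_sup]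
    constructor
    · by_cases hxc : x ∈ closure Ω
      · have hfr : x ∈ frontier Ω := by
          rw [H.isOpen.frontier_eq]; exact ⟨hxc, hx⟩
        have hneg : -(2 * d : ℝ)⁻¹ < 0 := by
          have : (0 : ℝ) < d := by positivity
          simp; positivity
        have h1 := Real.tendsto_exp_atBot.comp
          ((H.tendsto x hfr).const_mul_atTop_of_neg hneg)
        refine h1.congr' ?_
        filter_upwards [self_mem_nhdsWithin] with y hy
        simp [profile, Set.indicator_of_mem hy]
      · rw [mem_closure_iff_nhdsWithin_neBot, not_neBot] at hxc
        rw [hxc]; exact tendsto_bot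
    · refine tendsto_const_nhds.congr' ?_
      filter_upwards [self_mem_nhdsWithin] with y hy
      exact (profile_eq_zero hy).symm

theorem hasSecondJet_profile (H : IsBlowUpSolution d Ω g) {x : Fin d → ℝ} (hx : x ∈ Ω)
    (v : Fin d → ℝ) :
    HasSecondJet (fun s => profile d Ω g (x + s • v))
      (profile d Ω g x * (-(2 * d : ℝ)⁻¹ * fderiv ℝ g x v))
      (profile d Ω g x * ((-(2 * d : ℝ)⁻¹ * fderiv ℝ g x v) ^ 2
        + -(2 * d : ℝ)⁻¹ * (v ⬝ᵥ (hess d g x).mulVec v))) := by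
  have h := (((H.contDiffAt hx).hasSecondJet_line v).const_mul (-(2 * d : ℝ)⁻¹)).exp
  have hev : ∀ᶠ s : ℝ in 𝓝 0, x + s • v ∈ Ω := by
    have hc : ContinuousAt (fun s : ℝ => x + s • v) 0 := by fun_prop
    exact hc.eventually_mem (H.isOpen.mem_nhds (by simpa using hx))
  have hfx : profile d Ω g x = Real.exp (-(2 * d : ℝ)⁻¹ * g (x + (0 : ℝ) • v)) := by
    simp [profile, Set.indicator_of_mem hx]
  rw [hfx]
  obtain ⟨u', h1, h2, h3⟩ := h
  refine ⟨u', ?_, h2, h3⟩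
  filter_upwards [h1, hev.eventually_nhds] with s hs hs'
  refine hs.congr_of_eventuallyEq ?_
  filter_upwards [hs'] with r hr
  rw [profile, Set.indicator_of_mem hr]

theorem combo_mem (H : IsBlowUpSolution d Ω g) {p w : Fin d → ℝ} (hp : p ∈ Ω)
    (hw : w ∈ closure Ω) {t : ℝ} (ht0 : 0 ≤ t) (ht1 : t < 1) : p + t • (w - p) ∈ Ω := by
  have h := H.convex.combo_interior_closure_mem_interior (x := p) (y := w) (a := 1 - t) (b := t)
    (by rwa [H.isOpen.interior_eq]) hw (by linarith) ht0 (by ring)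
  rw [H.isOpen.interior_eq] at h
  convert h using 1
  module

/-- Comparison of a blow-up solution with its dilations. -/
theorem smul_profile_le (H : IsBlowUpSolution d Ω g) (hd : 0 < d) {p y : Fin d → ℝ} (hp : p ∈ Ω)
    (hy : y ∈ Ω) {t : ℝ} (ht0 : 0 < t) (ht1 : t < 1) :
    t * profile d Ω g y ≤ profile d Ω g (p + t • (y - p)) := by
  set f := profile d Ω g with hf
  have hfc : Continuous f := H.continuous_profile hd
  have hden : ∀ w ∈ closure Ω, 0 < f (p + t • (w - p)) := fun w hw =>
    profile_pos (H.combo_mem hp hw ht0.le ht1)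
  have hcont : ContinuousOn (fun w => f w / f (p + t • (w - p))) (closure Ω) :=
    hfc.continuousOn.div (by fun_prop) fun w hw => (hden w hw).ne'
  obtain ⟨w, hw, hmax⟩ := H.isBounded.isCompact_closure.exists_isMaxOn ⟨y, subset_closure hy⟩ hcont
  have hwy := hmax (subset_closure hy)
  simp only [Set.mem_ofPred_eq] at hwy
  have hwpos : 0 < f w := by
    have h1 : 0 < f y / f (p + t • (y - p)) :=
      div_pos (profile_pos hy) (hden y (subset_closure hy))
    have h2 := h1.trans_le hwy
    by_contra! h3
    exact absurd (div_nonpos_of_nonpos_of_nonneg h3 (hden w hw).le) (not_le.2 h2)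
  have hwΩ : w ∈ Ω := by
    by_contra h
    exact hwpos.ne' (profile_eq_zero h)
  set z := p + t • (w - p) with hz
  have hzΩ : z ∈ Ω := H.combo_mem hp hw ht0.le ht1
  set κ := f w / f z with hκ
  have hκpos : 0 < κ := div_pos hwpos (hden w hw)
  have hκz : κ * f z = f w := div_mul_cancel₀ _ (hden w hw).ne'
  have hle : ∀ w' ∈ Ω, f w' ≤ κ * f (p + t • (w' - p)) := fun w' hw' => by
    have := hmax (subset_closure hw')
    exact (div_le_iff₀ (hden w' (subset_closure hw'))).1 this
  have hquad : ∀ v : Fin d → ℝ,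
      v ⬝ᵥ (t ^ 2 • hess d g z).mulVec v ≤ v ⬝ᵥ (hess d g w).mulVec v := by
    intro v
    have hj := (H.hasSecondJet_profile hwΩ v).add
      ((H.hasSecondJet_profile hzΩ (t • v)).const_mul (-κ))
    have hlm : IsLocalMax (fun s : ℝ => f (w + s • v) + -κ * f (z + s • t • v)) 0 := by
      have hc : ContinuousAt (fun s : ℝ => w + s • v) 0 := by fun_prop
      filter_upwards [hc.eventually_mem (H.isOpen.mem_nhds (by simpa using hwΩ))] with s hs
      have h1 := hle _ hs
      have h2 : p + t • (w + s • v - p) = z + s • t • v := by rw [hz]; module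
      rw [h2] at h1
      simp only [zero_smul, add_zero]
      linarith
    obtain ⟨h1, h2⟩ := hj.of_isLocalMax hlm
    simp only [← hf, map_smul, smul_eq_mul, Matrix.mulVec_smul, smul_dotProduct,
      dotProduct_smul, Matrix.smul_mulVec] at h1 h2 ⊢
    have hdp : (0 : ℝ) < (2 * d : ℝ)⁻¹ := by positivity
    set ν := (2 * d : ℝ)⁻¹
    set Dw := fderiv ℝ g w v
    set Dz := fderiv ℝ g z v
    set Qw := v ⬝ᵥ (hess d g w).mulVec v
    set Qz := v ⬝ᵥ (hess d g z).mulVec v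
    have h3 : Dw = t * Dz := by
      have : f w * ν * (Dw - t * Dz) = 0 := by
        linear_combination -h1 + ν * t * Dz * hκz
      have h4 : f w * ν ≠ 0 := by positivity
      have := (mul_eq_zero.1 this).resolve_left h4
      linarith
    rw [h3] at h2
    have h5 : f w * ν * (t ^ 2 * Qz) ≤ f w * ν * Qw := by
      have e : κ * f z * (ν * t ^ 2 * Qz - (ν * t * Dz) ^ 2)
        = f w * (ν * t ^ 2 * Qz - (ν * t * Dz) ^ 2) := by rw [hκz]
      nlinarith [h2, e]
    exact le_of_mul_le_mul_left h5 (by positivity)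
  have hdet := (H.posDef w hwΩ).det_le_det ((H.posDef z hzΩ).smul (by positivity : 0 < t ^ 2)) hquad
  rw [Matrix.det_smul, Fintype.card_fin] at hdet
  have hdw := H.det_mul_profile_pow hd hwΩ
  have hdz := H.det_mul_profile_pow hd hzΩ
  rw [← hf] at hdw hdz
  have hzpos := hden w hw
  have hpow : (t * f w) ^ (2 * d) ≤ f z ^ (2 * d) := by
    have h1 : (0 : ℝ) < 2 ^ d := by positivity
    have h2 : 0 < f w ^ (2 * d) * f z ^ (2 * d) := by positivity
    have h3 := mul_le_mul_of_nonneg_right hdet h2.le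
    have h4 : (2 : ℝ) ^ d * (t * f w) ^ (2 * d) ≤ 2 ^ d * f z ^ (2 * d) := by
      calc (2 : ℝ) ^ d * (t * f w) ^ (2 * d)
          = (t ^ 2) ^ d * (hess d g z).det * (f w ^ (2 * d) * f z ^ (2 * d)) := by
            rw [← hdz]; ring
        _ ≤ _ := h3
        _ = 2 ^ d * f z ^ (2 * d) := by rw [← hdw]; ring
    exact le_of_mul_le_mul_left h4 h1
  have hroot : t * f w ≤ f z := le_of_pow_le_pow_left₀ (by positivity) hzpos.le hpow
  have hκt : κ ≤ 1 / t := by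
    rw [hκ, div_le_div_iff₀ hzpos ht0]; linarith
  have h6 := hwy.trans hκt
  rw [div_le_div_iff₀ (hden y (subset_closure hy)) ht0] at h6
  linarith

/-- Midpoint comparison of the profile with its dilations: the maximum of the quotient is excluded
by a two-point maximum principle. -/
theorem smul_profile_add_le (H : IsBlowUpSolution d Ω g) (hd : 0 < d) {p x y : Fin d → ℝ}
    (hp : p ∈ Ω) (hx : x ∈ Ω) (hy : y ∈ Ω) {t : ℝ} (ht0 : 0 < t) (ht1 : t < 1) :
    t * (profile d Ω g x + profile d Ω g y)
      ≤ 2 * profile d Ω g (p + t • ((2⁻¹ : ℝ) • (x + y) - p)) := by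
  set f := profile d Ω g with hf
  have hfc : Continuous f := H.continuous_profile hd
  have hclo : Convex ℝ (closure Ω) := H.convex.closure
  have hmem : ∀ a ∈ closure Ω, ∀ b ∈ closure Ω, p + t • ((2⁻¹ : ℝ) • (a + b) - p) ∈ Ω := by
    intro a ha b hb
    refine H.combo_mem hp ?_ ht0.le ht1
    rw [smul_add]
    exact hclo ha hb (by norm_num) (by norm_num) (by norm_num)
  set K : Set ((Fin d → ℝ) × (Fin d → ℝ)) := closure Ω ×ˢ closure Ω with hK
  have hden : ∀ w ∈ K, 0 < f (p + t • ((2⁻¹ : ℝ) • (w.1 + w.2) - p)) := fun w hw =>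
    profile_pos (hmem _ hw.1 _ hw.2)
  have hcont : ContinuousOn
      (fun w => (f w.1 + f w.2) / f (p + t • ((2⁻¹ : ℝ) • (w.1 + w.2) - p))) K :=
    ContinuousOn.div (by fun_prop) (by fun_prop) fun w hw => (hden w hw).ne'
  have hxyK : (x, y) ∈ K := ⟨subset_closure hx, subset_closure hy⟩
  obtain ⟨⟨x₀, y₀⟩, hw, hmax⟩ := (H.isBounded.isCompact_closure.prod
    H.isBounded.isCompact_closure).exists_isMaxOn ⟨(x, y), hxyK⟩ hcont
  have hwy := hmax hxyK
  simp only [Set.mem_ofPred_eq] at hwy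
  set z := p + t • ((2⁻¹ : ℝ) • (x₀ + y₀) - p) with hz
  have hzΩ : z ∈ Ω := hmem _ hw.1 _ hw.2
  have hzpos : 0 < f z := profile_pos hzΩ
  suffices hmain : t * (f x₀ + f y₀) ≤ 2 * f z by
    have h1 : (f x₀ + f y₀) / f z ≤ 2 / t := by
      rw [div_le_div_iff₀ hzpos ht0]; linarith
    have h2 := hwy.trans h1
    rw [div_le_div_iff₀ (hden _ hxyK) ht0] at h2
    linarith
  have hboundary : ∀ a ∈ closure Ω, ∀ b ∈ Ω,
      t * f b ≤ 2 * f (p + t • ((2⁻¹ : ℝ) • (a + b) - p)) := by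
    intro a ha b hb
    have h2t : (0 : ℝ) < 2 - t := by linarith
    have hp' : p + (t / (2 - t)) • (a - p) ∈ Ω :=
      H.combo_mem hp ha (by positivity) (by rw [div_lt_one h2t]; linarith)
    have h1 := H.smul_profile_le hd hp' hb (t := t / 2) (by positivity) (by linarith)
    have h2 : p + (t / (2 - t)) • (a - p) + (t / 2) • (b - (p + (t / (2 - t)) • (a - p)))
        = p + t • ((2⁻¹ : ℝ) • (a + b) - p) := by
      funext i
      simp only [Pi.add_apply, Pi.smul_apply, Pi.sub_apply, smul_eq_mul]
      field_simp
      ring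
    rw [h2] at h1
    linarith
  by_cases hx₀ : x₀ ∈ Ω
  swap
  · rw [show f x₀ = 0 from profile_eq_zero hx₀, zero_add]
    by_cases hy₀ : y₀ ∈ Ω
    · exact hboundary _ hw.1 _ hy₀
    · rw [show f y₀ = 0 from profile_eq_zero hy₀]; linarith
  by_cases hy₀ : y₀ ∈ Ω
  swap
  · rw [show f y₀ = 0 from profile_eq_zero hy₀, add_zero]
    have := hboundary _ hw.2 _ hx₀
    rwa [add_comm y₀ x₀] at this
  have hxpos : 0 < f x₀ := profile_pos hx₀
  have hypos : 0 < f y₀ := profile_pos hy₀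
  obtain ⟨κ, hκ⟩ : ∃ κ, κ = (f x₀ + f y₀) / f z := ⟨_, rfl⟩
  have hκz : κ * f z = f x₀ + f y₀ := by rw [hκ]; exact div_mul_cancel₀ _ hzpos.ne'
  have hle : ∀ a ∈ Ω, ∀ b ∈ Ω,
      f a + f b ≤ κ * f (p + t • ((2⁻¹ : ℝ) • (a + b) - p)) := fun a ha b hb => by
    have hab : (a, b) ∈ K := ⟨subset_closure ha, subset_closure hb⟩
    have := hmax hab
    rw [hκ]
    exact (div_le_iff₀ (hden _ hab)).1 this
  have hjet : ∀ a b : Fin d → ℝ,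
      f x₀ * fderiv ℝ g x₀ a + f y₀ * fderiv ℝ g y₀ b
        = (f x₀ + f y₀) * fderiv ℝ g z ((t * 2⁻¹) • (a + b)) ∧
      f x₀ * ((2 * d : ℝ)⁻¹ * fderiv ℝ g x₀ a ^ 2 - a ⬝ᵥ (hess d g x₀).mulVec a)
        + f y₀ * ((2 * d : ℝ)⁻¹ * fderiv ℝ g y₀ b ^ 2 - b ⬝ᵥ (hess d g y₀).mulVec b)
        ≤ (f x₀ + f y₀) * ((2 * d : ℝ)⁻¹ * fderiv ℝ g z ((t * 2⁻¹) • (a + b)) ^ 2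
          - ((t * 2⁻¹) • (a + b)) ⬝ᵥ (hess d g z).mulVec ((t * 2⁻¹) • (a + b))) := by
    intro a b
    have hj := ((H.hasSecondJet_profile hx₀ a).add (H.hasSecondJet_profile hy₀ b)).add
      ((H.hasSecondJet_profile hzΩ ((t * 2⁻¹) • (a + b))).const_mul (-κ))
    have hlm : IsLocalMax (fun s : ℝ => f (x₀ + s • a) + f (y₀ + s • b)
        + -κ * f (z + s • (t * 2⁻¹) • (a + b))) 0 := by
      have hca : ContinuousAt (fun s : ℝ => x₀ + s • a) 0 := by fun_prop
      have hcb : ContinuousAt (fun s : ℝ => y₀ + s • b) 0 := by fun_prop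
      filter_upwards [hca.eventually_mem (H.isOpen.mem_nhds (by simpa using hx₀)),
        hcb.eventually_mem (H.isOpen.mem_nhds (by simpa using hy₀))] with s hsa hsb
      have h1 := hle _ hsa _ hsb
      have h2 : p + t • ((2⁻¹ : ℝ) • (x₀ + s • a + (y₀ + s • b)) - p)
          = z + s • (t * 2⁻¹) • (a + b) := by rw [hz]; module
      rw [h2] at h1
      simp only [zero_smul, add_zero]
      linarith
    obtain ⟨h1, h2⟩ := hj.of_isLocalMax hlm
    simp only [← hf] at h1 h2
    have hdp : (0 : ℝ) < (2 * d : ℝ)⁻¹ := by positivity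
    generalize (2 * d : ℝ)⁻¹ = ν at *
    generalize fderiv ℝ g z ((t * 2⁻¹) • (a + b)) = Dz at *
    generalize ((t * 2⁻¹) • (a + b)) ⬝ᵥ (hess d g z).mulVec ((t * 2⁻¹) • (a + b)) = Qz at *
    rw [← hκz]
    constructor
    · refine mul_left_cancel₀ hdp.ne' ?_
      linear_combination -h1
    · refine le_of_mul_le_mul_left ?_ hdp
      linarith
  have hgradx : ∀ a, f x₀ * fderiv ℝ g x₀ a
      = (f x₀ + f y₀) * fderiv ℝ g z ((t * 2⁻¹) • a) := fun a => by
    simpa using (hjet a 0).1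
  have hgrady : ∀ b, f y₀ * fderiv ℝ g y₀ b
      = (f x₀ + f y₀) * fderiv ℝ g z ((t * 2⁻¹) • b) := fun b => by
    simpa using (hjet 0 b).1
  have hquad : ∀ a b : Fin d → ℝ,
      (f x₀ + f y₀) * ((2⁻¹ : ℝ) • (a + b) ⬝ᵥ (t ^ 2 • hess d g z).mulVec ((2⁻¹ : ℝ) • (a + b)))
        ≤ f x₀ * (a ⬝ᵥ (hess d g x₀).mulVec a) + f y₀ * (b ⬝ᵥ (hess d g y₀).mulVec b) := by
    intro a b
    have h1 := (hjet a b).2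
    have ha := hgradx a
    have hb := hgrady b
    have hlin : fderiv ℝ g z ((t * 2⁻¹) • (a + b))
        = fderiv ℝ g z ((t * 2⁻¹) • a) + fderiv ℝ g z ((t * 2⁻¹) • b) := by
      rw [smul_add, map_add]
    have hQ : (2⁻¹ : ℝ) • (a + b) ⬝ᵥ (t ^ 2 • hess d g z).mulVec ((2⁻¹ : ℝ) • (a + b))
        = ((t * 2⁻¹) • (a + b)) ⬝ᵥ (hess d g z).mulVec ((t * 2⁻¹) • (a + b)) := by
      simp only [Matrix.mulVec_smul, smul_dotProduct, dotProduct_smul, Matrix.smul_mulVec,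
        smul_eq_mul]
      ring
    rw [hQ]
    rw [hlin] at h1
    have hdp : (0 : ℝ) < (2 * d : ℝ)⁻¹ := by positivity
    generalize (2 * d : ℝ)⁻¹ = ν at *
    generalize fderiv ℝ g z ((t * 2⁻¹) • a) = Pa at *
    generalize fderiv ℝ g z ((t * 2⁻¹) • b) = Pb at *
    generalize fderiv ℝ g x₀ a = Da at *
    generalize fderiv ℝ g y₀ b = Db at *
    have hcs : (f x₀ + f y₀) * (Pa + Pb) ^ 2 ≤ f x₀ * Da ^ 2 + f y₀ * Db ^ 2 := by
      have e : (f x₀ + f y₀) * (f x₀ * Da ^ 2 + f y₀ * Db ^ 2 - (f x₀ + f y₀) * (Pa + Pb) ^ 2)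
          = f x₀ * f y₀ * (Da - Db) ^ 2 := by
        have e1 : (f x₀ + f y₀) * (Pa + Pb) = f x₀ * Da + f y₀ * Db := by rw [ha, hb]; ring
        linear_combination (-(f x₀ + f y₀) * (Pa + Pb) - (f x₀ * Da + f y₀ * Db)) * e1
      have e2 : 0 ≤ f x₀ * f y₀ * (Da - Db) ^ 2 := by positivity
      rw [← e] at e2
      have := nonneg_of_mul_nonneg_right e2 (by positivity)
      linarith
    nlinarith [mul_le_mul_of_nonneg_left hcs hdp.le]
  have hG : (t ^ 2 • hess d g z).PosDef := (H.posDef z hzΩ).smul (by positivity : 0 < t ^ 2)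
  have hdet := (H.posDef x₀ hx₀).det_mul_pow_le_of_mean_bound (H.posDef y₀ hy₀) hG hxpos hypos
    (c := 2 ^ d) (by rw [Fintype.card_fin]; exact H.det_mul_profile_pow hd hx₀)
    (by rw [Fintype.card_fin]; exact H.det_mul_profile_pow hd hy₀) hquad
  rw [Matrix.det_smul, Fintype.card_fin] at hdet
  have hdz := H.det_mul_profile_pow hd hzΩ
  rw [← hf] at hdz
  have hdzpos : 0 < (hess d g z).det := (H.posDef z hzΩ).det_pos
  have hpow : (t * ((f x₀ + f y₀) / 2)) ^ (2 * d) ≤ f z ^ (2 * d) := by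
    refine le_of_mul_le_mul_left ?_ hdzpos
    calc (hess d g z).det * (t * ((f x₀ + f y₀) / 2)) ^ (2 * d)
        = (t ^ 2) ^ d * (hess d g z).det * ((f x₀ + f y₀) / 2) ^ (2 * d) := by
          rw [mul_pow, ← pow_mul]; ring
      _ ≤ 2 ^ d := hdet
      _ = _ := hdz.symm
  have := le_of_pow_le_pow_left₀ (by positivity) hzpos.le hpow
  linarith

theorem profile_add_le (H : IsBlowUpSolution d Ω g) (hd : 0 < d) {x y : Fin d → ℝ}
    (hx : x ∈ Ω) (hy : y ∈ Ω) :
    profile d Ω g x + profile d Ω g y ≤ 2 * profile d Ω g ((2⁻¹ : ℝ) • (x + y)) := by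
  have hfc : Continuous (profile d Ω g) := H.continuous_profile hd
  have h1 : Tendsto (fun t : ℝ => t * (profile d Ω g x + profile d Ω g y)) (𝓝[<] 1)
      (𝓝 (1 * (profile d Ω g x + profile d Ω g y))) :=
    (Continuous.tendsto (by fun_prop) 1).mono_left nhdsWithin_le_nhds
  have h2 : Tendsto (fun t : ℝ => 2 * profile d Ω g (x + t • ((2⁻¹ : ℝ) • (x + y) - x))) (𝓝[<] 1)
      (𝓝 (2 * profile d Ω g (x + (1 : ℝ) • ((2⁻¹ : ℝ) • (x + y) - x)))) :=
    (Continuous.tendsto (by fun_prop) 1).mono_left nhdsWithin_le_nhds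
  rw [one_mul] at h1
  rw [one_smul, add_sub_cancel] at h2
  refine le_of_tendsto_of_tendsto h1 h2 ?_
  filter_upwards [Ioo_mem_nhdsLT (zero_lt_one' ℝ)] with t ht
  exact H.smul_profile_add_le hd hx hx hy ht.1 ht.2

/-- Concavity of `exp (-g / 2d)`, in terms of the derivatives of `g`. -/
theorem sq_fderiv_le (H : IsBlowUpSolution d Ω g) (hd : 0 < d) {x : Fin d → ℝ} (hx : x ∈ Ω)
    (v : Fin d → ℝ) :
    fderiv ℝ g x v ^ 2 ≤ 2 * d * (v ⬝ᵥ (hess d g x).mulVec v) := by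
  have hj := (H.hasSecondJet_profile hx v).add (H.hasSecondJet_profile hx (-v))
  have hlm : IsLocalMax
      (fun s : ℝ => profile d Ω g (x + s • v) + profile d Ω g (x + s • -v)) 0 := by
    have hca : ContinuousAt (fun s : ℝ => x + s • v) 0 := by fun_prop
    have hcb : ContinuousAt (fun s : ℝ => x + s • -v) 0 := by fun_prop
    filter_upwards [hca.eventually_mem (H.isOpen.mem_nhds (by simpa using hx)),
      hcb.eventually_mem (H.isOpen.mem_nhds (by simpa using hx))] with s hsa hsb
    have h1 := H.profile_add_le hd hsa hsb
    have h2 : (2⁻¹ : ℝ) • (x + s • v + (x + s • -v)) = x := by module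
    rw [h2] at h1
    simp only [zero_smul, add_zero]
    linarith
  have h := (hj.of_isLocalMax hlm).2
  have hfx : 0 < profile d Ω g x := profile_pos hx
  simp only [map_neg, Matrix.mulVec_neg, neg_dotProduct, dotProduct_neg, neg_neg] at h
  have hdp : (0 : ℝ) < 2 * d := by positivity
  have h1 : profile d Ω g x * (2 * (2 * d : ℝ)⁻¹ ^ 2) *
      (fderiv ℝ g x v ^ 2 - 2 * d * (v ⬝ᵥ (hess d g x).mulVec v)) ≤ 0 := by
    have e : (2 * d : ℝ)⁻¹ ^ 2 * (2 * d) = (2 * d : ℝ)⁻¹ := by field_simp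
    refine le_of_eq_of_le ?_ h
    linear_combination (-2 * profile d Ω g x * (v ⬝ᵥ (hess d g x).mulVec v)) * e
  have h2 := nonpos_of_mul_nonpos_right h1 (by positivity)
  linarith

theorem gradv_dotProduct_inv_hess_mulVec_le (H : IsBlowUpSolution d Ω g) (hd : 0 < d)
    {x : Fin d → ℝ} (hx : x ∈ Ω) :
    gradv d g x ⬝ᵥ ((hess d g x)⁻¹).mulVec (gradv d g x) ≤ 2 * d := by
  set v := ((hess d g x)⁻¹).mulVec (gradv d g x) with hv
  have hunit : IsUnit (hess d g x).det := (H.posDef x hx).det_pos.ne'.isUnit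
  have hmul : (hess d g x).mulVec v = gradv d g x := by
    rw [hv, Matrix.mulVec_mulVec, Matrix.mul_nonsing_inv _ hunit, Matrix.one_mulVec]
  have h := H.sq_fderiv_le hd hx v
  rw [hmul, dotProduct_comm v, ← dotProduct_gradv] at h
  by_contra! hlt
  have hdp : (0 : ℝ) < 2 * d := by positivity
  nlinarith

end IsBlowUpSolution

/-- Uniform bound on `∇g(x)ᵀ (∇²g(x))⁻¹ ∇g(x)` over the simplex. -/
theorem grad_inv_hess_grad_bounded (d : ℕ) (hd : 1 ≤ d) (g : (Fin d → ℝ) → ℝ)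
    (hg : ContDiffOn ℝ (⊤ : ℕ∞) g (simplexΔ d))
    (hpos : ∀ x ∈ simplexΔ d, (hess d g x).PosDef)
    (hMA : ∀ x ∈ simplexΔ d, g x = Real.log (((2 : ℝ)⁻¹ • hess d g x).det))
    (hbd : ∀ x0 ∈ frontier (simplexΔ d),
      Filter.Tendsto g (nhdsWithin x0 (simplexΔ d)) Filter.atTop) :
    ∃ C : ℝ, ∀ x ∈ simplexΔ d,
      gradv d g x ⬝ᵥ ((hess d g x)⁻¹).mulVec (gradv d g x) ≤ C := by
  have hdet : ∀ x ∈ simplexΔ d, (hess d g x).det = 2 ^ d * Real.exp (g x) := by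
    intro x hx
    have hp := (hpos x hx).det_pos
    rw [hMA x hx, Matrix.det_smul, Fintype.card_fin, Real.exp_log (by positivity), ← mul_assoc,
      ← mul_pow]
    norm_num
  have H : IsBlowUpSolution d (simplexΔ d) g :=
    { isOpen := isOpen_simplexΔ d
      convex := convex_simplexΔ d
      isBounded := isBounded_simplexΔ d
      contDiffOn := hg.of_le (WithTop.coe_le_coe.2 le_top)
      posDef := hpos
      det_eq := hdet
      tendsto := hbd }
  exact ⟨2 * d, fun x hx => H.gradv_dotProduct_inv_hess_mulVec_le hd hx⟩
end
end
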